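/- Let k ≥ 3 and let 0 = i_0 < i_1 < ⋯ < i_k be integers. If for some n with 1 ≤ n ≤ k−2 one has i_n ≤ k−n, then the ideal I_I^A is generated by the k−n elements S_{n+1}, S_{n+2}, …, S_k, i.e. Ideal.span{S_0,…,S_k} = Ideal.span{S_{n+1},…,S_k} in R. -/

import Mathlib

open MvPolynomial

/-- The complete homogeneous symmetric polynomial of degree `d ∈ ℤ` in the variables
`x₁, …, x_k`, with the convention `h_d = 0` for `d < 0` (and `h_0 = 1`). -/
noncomputable def completeHomog (k : ℕ) (d : ℤ) : MvPolynomial (Fin k) ℂ :=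
  if 0 ≤ d then
    ∑ μ ∈ Finset.Nat.antidiagonalTuple k d.toNat, ∏ b : Fin k, (X b : MvPolynomial (Fin k) ℂ) ^ μ b
  else 0

/-- The `(k+1) × k` matrix `H` over `R = ℂ[x₁,…,x_k]` with `(a,b)`-entry `h_{i_a - (k - b)}`
(rows `a = 0,…,k`, columns `b = 1,…,k`). -/
noncomputable def Hmat (k : ℕ) (i : Fin (k + 1) → ℕ) :
    Matrix (Fin (k + 1)) (Fin k) (MvPolynomial (Fin k) ℂ) :=
  Matrix.of fun a b => completeHomog k ((i a : ℤ) - ((k : ℤ) - 1 - (b : ℕ)))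

/-- `S_l`, the determinant of the `k × k` matrix obtained from `H` by deleting the row
indexed by `l`; up to sign it is the Schur polynomial of the exponent sequence obtained
from `(i₀,…,i_k)` by deleting `i_l`. -/
noncomputable def Spoly (k : ℕ) (i : Fin (k + 1) → ℕ) (l : Fin (k + 1)) :
    MvPolynomial (Fin k) ℂ :=
  Matrix.det (Matrix.of fun a b : Fin k => Hmat k i (l.succAbove a) b)

/-- The Vandermonde ideal `I_I^A ⊆ R`, generated by `S₀, S₁, …, S_k`. -/
noncomputable def vandermondeIdealA (k : ℕ) (i : Fin (k + 1) → ℕ) :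
    Ideal (MvPolynomial (Fin k) ℂ) :=
  Ideal.span (Set.range (Spoly k i))

theorem completeHomog_zero (k : ℕ) : completeHomog k 0 = 1 := by
  simp [completeHomog, Finset.Nat.antidiagonalTuple_zero_right]

theorem completeHomog_of_neg (k : ℕ) {d : ℤ} (hd : d < 0) : completeHomog k d = 0 :=
  if_neg (not_le.mpr hd)

/-- The alternating sum of the maximal minors of `H`, weighted by the entries of any column of `H`,
vanishes. -/
theorem sum_Hmat_mul_Spoly (k : ℕ) (i : Fin (k + 1) → ℕ) (b : Fin k) :
    ∑ l : Fin (k + 1), (-1) ^ (l : ℕ) * Hmat k i l b * Spoly k i l = 0 := by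
  let M : Matrix (Fin (k + 1)) (Fin (k + 1)) (MvPolynomial (Fin k) ℂ) :=
    Matrix.of fun a => Fin.cons (Hmat k i a b) (Hmat k i a)
  have hM : M.det = 0 :=
    Matrix.det_zero_of_column_eq (Fin.succ_ne_zero b).symm fun a => by simp [M]
  rw [Matrix.det_succ_column_zero] at hM
  exact hM

/-- If `i_l < k` then `S_l` is a combination of the `S_m` with `l < m`. -/
theorem Spoly_mem_of_forall_gt (k : ℕ) (i : Fin (k + 1) → ℕ) (hmono : StrictMono i)
    (J : Ideal (MvPolynomial (Fin k) ℂ)) (l : Fin (k + 1)) (hl : i l < k)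
    (hJ : ∀ m, l < m → Spoly k i m ∈ J) : Spoly k i l ∈ J := by
  let b : Fin k := ⟨k - 1 - i l, by omega⟩
  have hb (a : Fin (k + 1)) : Hmat k i a b = completeHomog k ((i a : ℤ) - i l) := by
    simp only [Hmat, Matrix.of_apply, b]
    congr 1
    omega
  have hsum := sum_Hmat_mul_Spoly k i b
  rw [← Finset.add_sum_erase _ _ (Finset.mem_univ l), hb l, sub_self, completeHomog_zero,
    mul_one] at hsum
  have hmem : (-1) ^ (l : ℕ) * Spoly k i l ∈ J := by
    rw [eq_neg_of_add_eq_zero_left hsum]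
    refine J.neg_mem (J.sum_mem fun m hm => ?_)
    rcases lt_or_gt_of_ne (Finset.ne_of_mem_erase hm) with h | h
    · have hlt := hmono h
      rw [hb m, completeHomog_of_neg k (by omega)]
      simp
    · exact J.mul_mem_left _ (hJ m h)
  have hmem' := J.mul_mem_left ((-1) ^ (l : ℕ)) hmem
  rwa [← mul_assoc, ← mul_pow, neg_one_mul, neg_neg, one_pow, one_mul] at hmem'

/-- Theorem `th:k*k+1`(v), second part: let `3 ≤ k` and `0 = i₀ < i₁ < ⋯ < i_k`. If for
some `n` with `1 ≤ n ≤ k - 2` one has `i_n ≤ k - n`, then the ideal `I_I^A` is generated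
by the `k - n` elements `S_{n+1}, S_{n+2}, …, S_k`. -/
theorem vandermonde_ideal_fewer_generators (k : ℕ) (hk : 3 ≤ k) (i : Fin (k + 1) → ℕ)
    (hi0 : i 0 = 0) (hmono : StrictMono i) (n : ℕ) (hn1 : 1 ≤ n) (hn2 : n ≤ k - 2)
    (hin : i ⟨n, by omega⟩ ≤ k - n) :
    vandermondeIdealA k i = Ideal.span (Spoly k i '' {l : Fin (k + 1) | n < (l : ℕ)}) := by
  refine le_antisymm (Ideal.span_le.mpr ?_) (Ideal.span_mono (Set.image_subset_range _ _))
  rintro _ ⟨l, rfl⟩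
  induction l using WellFoundedGT.induction with
  | ind l ih =>
    by_cases h : n < (l : ℕ)
    · exact Ideal.subset_span ⟨l, h, rfl⟩
    · have hle : i l ≤ i ⟨n, by omega⟩ := hmono.monotone (Fin.le_def.mpr (not_lt.mp h))
      exact Spoly_mem_of_forall_gt k i hmono _ l (by omega) ih
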